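/- Consider the full-feedback algorithm below, run with φ_{t,m} = l_{t,m} − ∑_{m'=1}^M p_{t,m'}·l_{t,m'} and learning rates η_t = min( √W/√V_t , W/D_t , 1/|Φ_t| ) for t ≥ 1 (with η_0 = η_{−1} = η_1), where V_t = ∑_{t'=1}^t ∑_m p_{t',m}·φ_{t',m}², D_t = max_{1≤t'≤t} (max_m φ_{t',m} − min_m φ_{t',m}), and Φ_t = min_{1≤t'≤t} min_m φ_{t',m} (terms of the min whose denominator is zero are omitted). Assume W > 0, V_1 > 0, D_1 > 0, |Φ_1| > 0. Then for every comparator path Λ_T = (λ_1,…,λ_T) with Τ(λ_t|λ_{t−1}) > 0 and complexity W(Λ_T) = log(max_{1≤t≤T}|Ω_{t−1}|) − log(∏_{t=1}^T Τ(λ_t|λ_{t−1})) ≤ W, the regret satisfies ∑_{t=1}^T ( ∑_{m=1}^M p_{t,m}·l_{t,m} − l_{t,ℓ_t(λ_t)} ) ≤ 2(1+W)·max_{1≤t≤T} Δ_t + 2·√( W·∑_{t=1}^T Δ_t² ), where Δ_t = max_m l_{t,m} − min_m l_{t,m}. -/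

import Mathlib

/-- A quadratic upper bound for the exponential on `(-∞, 1]`. -/
theorem exp_le_one_add_add_sq {x : ℝ} (hx : x ≤ 1) :
    Real.exp x ≤ 1 + x + 3 / 4 * x ^ 2 := by
  rcases le_total (-1) x with h | h
  · have habs : |x| ≤ 1 := abs_le.mpr ⟨h, hx⟩
    have hb := Real.exp_bound habs (n := 3) (by norm_num)
    have hcube : |x| ^ 3 ≤ x ^ 2 := by
      calc |x| ^ 3 = x ^ 2 * |x| := by rw [pow_succ, sq_abs]
        _ ≤ x ^ 2 * 1 := by gcongr
        _ = x ^ 2 := mul_one _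
    simp only [Finset.sum_range_succ, Finset.sum_range_zero, Nat.factorial] at hb
    norm_num at hb
    have := (abs_le.mp hb).2
    nlinarith [sq_nonneg x]
  · have h1 : Real.exp x ≤ 1 / 2 := by
      have h2 : Real.exp x ≤ Real.exp (-1) := Real.exp_le_exp.mpr h
      have h3 : Real.exp (-1) * Real.exp 1 = 1 := by rw [← Real.exp_add]; simp
      have h4 := Real.add_one_le_exp (1 : ℝ)
      nlinarith [Real.exp_pos (-1)]
    nlinarith

/-- The mix loss at rate `η` of a centred loss, bounded through a smaller rate `η'` for which
the losses are bounded below by `-1 / η'`. -/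
theorem log_sum_exp_div_le {ι : Type*} [Fintype ι] (p φ : ι → ℝ) (η η' : ℝ)
    (hp : ∀ i, 0 ≤ p i) (hp1 : ∑ i, p i = 1) (hc : ∑ i, p i * φ i = 0)
    (hη' : 0 < η') (hle : η' ≤ η) (hφ : ∀ i, -φ i ≤ 1 / η') :
    1 / η * Real.log (∑ i, p i * Real.exp (-η * φ i)) ≤
      3 / 4 * (η' * ∑ i, p i * φ i ^ 2) + (1 / η' - 1 / η) := by
  have hη : 0 < η := hη'.trans_le hle
  set v := ∑ i, p i * φ i ^ 2 with hv
  have hv0 : 0 ≤ v := Finset.sum_nonneg fun i _ => mul_nonneg (hp i) (sq_nonneg _)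
  have hsum : ∑ i, p i * Real.exp (-η' * φ i) ≤ 1 + 3 / 4 * η' ^ 2 * v := by
    calc ∑ i, p i * Real.exp (-η' * φ i)
        ≤ ∑ i, p i * (1 + (-η' * φ i) + 3 / 4 * (-η' * φ i) ^ 2) := by
          refine Finset.sum_le_sum fun i _ => mul_le_mul_of_nonneg_left ?_ (hp i)
          apply exp_le_one_add_add_sq
          have := mul_le_mul_of_nonneg_left (hφ i) hη'.le
          rw [mul_one_div_cancel hη'.ne'] at this
          linarith
      _ = ∑ i, p i - η' * ∑ i, p i * φ i + 3 / 4 * η' ^ 2 * v := by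
          rw [hv, Finset.mul_sum, Finset.mul_sum, ← Finset.sum_sub_distrib,
            ← Finset.sum_add_distrib]
          exact Finset.sum_congr rfl fun i _ => by ring
      _ = 1 + 3 / 4 * η' ^ 2 * v := by rw [hp1, hc]; ring
  have hbd : ∑ i, p i * Real.exp (-η * φ i) ≤
      Real.exp (3 / 4 * η' ^ 2 * v + (η - η') * (1 / η')) := by
    calc ∑ i, p i * Real.exp (-η * φ i)
        ≤ ∑ i, p i * Real.exp (-η' * φ i) * Real.exp ((η - η') * (1 / η')) := by
          refine Finset.sum_le_sum fun i _ => ?_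
          rw [mul_assoc, ← Real.exp_add]
          refine mul_le_mul_of_nonneg_left (Real.exp_le_exp.mpr ?_) (hp i)
          nlinarith [mul_le_mul_of_nonneg_left (hφ i) (sub_nonneg.mpr hle)]
      _ = (∑ i, p i * Real.exp (-η' * φ i)) * Real.exp ((η - η') * (1 / η')) := by
          rw [Finset.sum_mul]
      _ ≤ Real.exp (3 / 4 * η' ^ 2 * v) * Real.exp ((η - η') * (1 / η')) := by
          gcongr
          linarith [Real.add_one_le_exp (3 / 4 * η' ^ 2 * v)]
      _ = _ := by rw [Real.exp_add]
  have hpos : 0 < ∑ i, p i * Real.exp (-η * φ i) := by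
    have h0 : ∀ i ∈ Finset.univ, 0 ≤ p i * Real.exp (-η * φ i) :=
      fun i _ => mul_nonneg (hp i) (Real.exp_pos _).le
    obtain ⟨i, -, hi⟩ : ∃ i ∈ Finset.univ, p i ≠ 0 :=
      Finset.exists_ne_zero_of_sum_ne_zero (by rw [hp1]; exact one_ne_zero)
    exact Finset.sum_pos' h0 ⟨i, Finset.mem_univ i,
      mul_pos (lt_of_le_of_ne (hp i) (Ne.symm hi)) (Real.exp_pos _)⟩
  have hlog := (Real.log_le_iff_le_exp hpos).mpr hbd
  calc 1 / η * Real.log (∑ i, p i * Real.exp (-η * φ i))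
      ≤ 1 / η * (3 / 4 * η' ^ 2 * v + (η - η') * (1 / η')) := by gcongr
    _ = 3 / 4 * (η' * v) * (η' / η) + (1 / η' - 1 / η) := by field_simp
    _ ≤ 3 / 4 * (η' * v) * 1 + (1 / η' - 1 / η) := by
        gcongr
        exact (div_le_one hη).mpr hle
    _ = _ := by ring

/-- The logarithmic power-mean inequality for exponents in `(0, 1]`. -/
theorem log_sum_rpow_le {ι : Type*} (s : Finset ι) (z : ι → ℝ) (hz : ∀ i ∈ s, 0 ≤ z i)
    (hpos : 0 < ∑ i ∈ s, z i) {r : ℝ} (hr : 0 < r) (hr1 : r ≤ 1) :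
    Real.log (∑ i ∈ s, z i ^ r) ≤
      (1 - r) * Real.log s.card + r * Real.log (∑ i ∈ s, z i) := by
  have hs : s.Nonempty := by
    by_contra h
    rw [Finset.not_nonempty_iff_eq_empty] at h
    simp [h] at hpos
  have hN : (0 : ℝ) < s.card := by exact_mod_cast hs.card_pos
  have hnn : ∀ i ∈ s, 0 ≤ z i ^ r := fun i hi => Real.rpow_nonneg (hz i hi) r
  have hspos : 0 < ∑ i ∈ s, z i ^ r := by
    obtain ⟨i, hi, hzi⟩ := Finset.exists_ne_zero_of_sum_ne_zero hpos.ne'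
    exact Finset.sum_pos' hnn
      ⟨i, hi, Real.rpow_pos_of_pos (lt_of_le_of_ne (hz i hi) (Ne.symm hzi)) r⟩
  have key := Real.rpow_sum_le_const_mul_sum_rpow s (fun i => z i ^ r) (p := 1 / r)
    ((one_le_div hr).mpr hr1)
  have e1 : ∑ i ∈ s, |z i ^ r| = ∑ i ∈ s, z i ^ r :=
    Finset.sum_congr rfl fun i hi => abs_of_nonneg (hnn i hi)
  have e2 : ∑ i ∈ s, |z i ^ r| ^ (1 / r) = ∑ i ∈ s, z i :=
    Finset.sum_congr rfl fun i hi => by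
      rw [abs_of_nonneg (hnn i hi), ← Real.rpow_mul (hz i hi), mul_one_div_cancel hr.ne',
        Real.rpow_one]
  rw [e1, e2] at key
  have hlog := Real.log_le_log (Real.rpow_pos_of_pos hspos _) key
  rw [Real.log_rpow hspos, Real.log_mul (Real.rpow_pos_of_pos hN _).ne' hpos.ne',
    Real.log_rpow hN] at hlog
  have h2 := mul_le_mul_of_nonneg_left hlog hr.le
  have e3 : r * (1 / r * Real.log (∑ i ∈ s, z i ^ r)) = Real.log (∑ i ∈ s, z i ^ r) := by
    field_simp
  have e4 : r * ((1 / r - 1) * Real.log s.card + Real.log (∑ i ∈ s, z i)) =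
      (1 - r) * Real.log s.card + r * Real.log (∑ i ∈ s, z i) := by
    field_simp
  rwa [e3, e4] at h2

/-- A sum of nonnegative increments weighted by inverse square roots of the partial sums. -/
theorem sum_div_sqrt_partial_sum_le (v : ℕ → ℝ) (hv : ∀ t, 1 ≤ t → 0 ≤ v t) (n : ℕ) :
    ∑ t ∈ Finset.Icc 1 n, v t / Real.sqrt (∑ s ∈ Finset.Icc 1 t, v s) ≤
      2 * Real.sqrt (∑ s ∈ Finset.Icc 1 n, v s) := by
  induction n with
  | zero => simp
  | succ n ih =>
    rw [Finset.sum_Icc_succ_top (by omega)]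
    set A := ∑ s ∈ Finset.Icc 1 n, v s with hA
    have hB : ∑ s ∈ Finset.Icc 1 (n + 1), v s = A + v (n + 1) :=
      Finset.sum_Icc_succ_top (by omega) _
    rw [hB]
    have hA0 : 0 ≤ A := Finset.sum_nonneg fun t ht => hv t (Finset.mem_Icc.mp ht).1
    have hvn := hv (n + 1) (by omega)
    suffices h : v (n + 1) / √(A + v (n + 1)) ≤ 2 * (√(A + v (n + 1)) - √A) by linarith
    rcases (add_nonneg hA0 hvn).eq_or_lt with h0 | h0
    · have : A = 0 := by linarith
      rw [← h0, this]
      simp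
    · rw [div_le_iff₀ (Real.sqrt_pos.mpr h0)]
      nlinarith [Real.sq_sqrt h0.le, Real.sq_sqrt hA0, sq_nonneg (√(A + v (n + 1)) - √A)]

/-- Second moment of a centred variable with values in `[a, b]`. -/
theorem sum_mul_sq_le_of_centred {ι : Type*} [Fintype ι] (p φ : ι → ℝ) (a b : ℝ)
    (hp : ∀ i, 0 ≤ p i) (hp1 : ∑ i, p i = 1) (hc : ∑ i, p i * φ i = 0)
    (ha : ∀ i, a ≤ φ i) (hb : ∀ i, φ i ≤ b) :
    ∑ i, p i * φ i ^ 2 ≤ (b - a) ^ 2 / 4 := by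
  have h : 0 ≤ ∑ i, p i * ((φ i - a) * (b - φ i)) :=
    Finset.sum_nonneg fun i _ =>
      mul_nonneg (hp i) (mul_nonneg (sub_nonneg.mpr (ha i)) (sub_nonneg.mpr (hb i)))
  have e : ∑ i, p i * ((φ i - a) * (b - φ i)) =
      (a + b) * ∑ i, p i * φ i - a * b * ∑ i, p i - ∑ i, p i * φ i ^ 2 := by
    rw [Finset.mul_sum, Finset.mul_sum, ← Finset.sum_sub_distrib, ← Finset.sum_sub_distrib]
    exact Finset.sum_congr rfl fun i _ => by ring
  rw [e, hp1, hc] at h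
  nlinarith [sq_nonneg (a + b)]

/-- Weights stay nonnegative, and positive along a path with positive transition weights. -/
theorem weights_nonneg_and_pos {Λ : Type*} (T : ℕ) (Ω : ℕ → Finset Λ) (Tr : ℕ → Λ → Λ → ℝ)
    (hTr0 : ∀ t a b, 0 ≤ Tr t a b) (r : ℕ → ℝ) (w z e : ℕ → Λ → ℝ) (he : ∀ t a, 0 < e t a)
    (hz0 : ∀ a ∈ Ω 0, z 0 a = 1)
    (hw : ∀ t < T, ∀ a ∈ Ω (t + 1), w (t + 1) a = ∑ b ∈ Ω t, Tr (t + 1) b a * z t b ^ r t)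
    (hz : ∀ t < T, ∀ a ∈ Ω (t + 1), z (t + 1) a = w (t + 1) a * e (t + 1) a)
    (lam : ℕ → Λ) (hlam : ∀ t ≤ T, lam t ∈ Ω t)
    (hlamTr : ∀ t < T, 0 < Tr (t + 1) (lam t) (lam (t + 1))) :
    (∀ t ≤ T, (∀ a ∈ Ω t, 0 ≤ z t a) ∧ 0 < z t (lam t)) ∧
      ∀ t < T, (∀ a ∈ Ω (t + 1), 0 ≤ w (t + 1) a) ∧ 0 < w (t + 1) (lam (t + 1)) := by
  have step : ∀ t < T, ((∀ a ∈ Ω t, 0 ≤ z t a) ∧ 0 < z t (lam t)) →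
      (∀ a ∈ Ω (t + 1), 0 ≤ w (t + 1) a) ∧ 0 < w (t + 1) (lam (t + 1)) := by
    rintro t ht ⟨h0, hpos⟩
    have hterm : ∀ a, ∀ b ∈ Ω t, 0 ≤ Tr (t + 1) b a * z t b ^ r t := fun a b hb =>
      mul_nonneg (hTr0 _ _ _) (Real.rpow_nonneg (h0 b hb) _)
    refine ⟨fun a ha => ?_, ?_⟩
    · rw [hw t ht a ha]
      exact Finset.sum_nonneg (hterm a)
    · rw [hw t ht _ (hlam _ ht)]
      exact Finset.sum_pos' (hterm _) ⟨lam t, hlam t ht.le,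
        mul_pos (hlamTr t ht) (Real.rpow_pos_of_pos hpos _)⟩
  have hzall : ∀ t ≤ T, (∀ a ∈ Ω t, 0 ≤ z t a) ∧ 0 < z t (lam t) := by
    intro t
    induction t with
    | zero =>
      intro h
      refine ⟨fun a ha => by rw [hz0 a ha]; exact zero_le_one, ?_⟩
      rw [hz0 _ (hlam 0 h)]
      exact one_pos
    | succ t ih =>
      intro ht
      obtain ⟨h1, h2⟩ := step t ht (ih (by omega))
      refine ⟨fun a ha => ?_, ?_⟩
      · rw [hz t ht a ha]
        exact mul_nonneg (h1 a ha) (he _ _).le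
      · rw [hz t ht _ (hlam _ ht)]
        exact mul_pos h2 (he _ _)
  exact ⟨hzall, fun t ht => step t ht (hzall t ht.le)⟩

/-- Regret of exponential weights with transitions and nonincreasing rates, in terms of the
normalised mix losses `c`. -/
theorem neg_sum_le_of_weights {Λ : Type*} (T : ℕ) (Ω : ℕ → Finset Λ)
    (Tr : ℕ → Λ → Λ → ℝ) (hTr0 : ∀ t a b, 0 ≤ Tr t a b)
    (hTr1 : ∀ t < T, ∀ a ∈ Ω t, ∑ b ∈ Ω (t + 1), Tr (t + 1) a b = 1)
    (hΩ0 : (Ω 0).card = 1) (N : ℕ) (hN : ∀ t < T, (Ω t).card ≤ N)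
    (η : ℕ → ℝ) (hηpos : ∀ t ≤ T, 0 < η t) (hηanti : ∀ t < T, η t ≤ η (t - 1))
    (w z g : ℕ → Λ → ℝ) (hz0 : ∀ a ∈ Ω 0, z 0 a = 1)
    (hw : ∀ t < T, ∀ a ∈ Ω (t + 1),
      w (t + 1) a = ∑ b ∈ Ω t, Tr (t + 1) b a * z t b ^ (η t / η (t - 1)))
    (hz : ∀ t < T, ∀ a ∈ Ω (t + 1), z (t + 1) a = w (t + 1) a * Real.exp (-η t * g (t + 1) a))
    (lam : ℕ → Λ) (hlam : ∀ t ≤ T, lam t ∈ Ω t)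
    (hlamTr : ∀ t < T, 0 < Tr (t + 1) (lam t) (lam (t + 1)))
    (c : ℕ → ℝ) (hc : ∀ t < T, ∑ a ∈ Ω (t + 1), z (t + 1) a =
      (∑ a ∈ Ω (t + 1), w (t + 1) a) * c (t + 1)) (hcpos : ∀ t < T, 0 < c (t + 1))
    (hT : 1 ≤ T) :
    -∑ t ∈ Finset.Icc 1 T, g t (lam t) ≤
      1 / η (T - 1) *
        (Real.log N - Real.log (∏ t ∈ Finset.Icc 1 T, Tr t (lam (t - 1)) (lam t))) +
      ∑ t ∈ Finset.Icc 1 T, 1 / η (t - 1) * Real.log (c t) := by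
  obtain ⟨hzp, hwp⟩ := weights_nonneg_and_pos T Ω Tr hTr0 (fun t => η t / η (t - 1)) w z
    (fun t a => Real.exp (-η (t - 1) * g t a)) (fun _ _ => Real.exp_pos _) hz0 hw hz lam hlam
    hlamTr
  have hZpos : ∀ t ≤ T, 0 < ∑ a ∈ Ω t, z t a := fun t ht =>
    Finset.sum_pos' (hzp t ht).1 ⟨lam t, hlam t ht, (hzp t ht).2⟩
  have hSpos : ∀ t < T, 0 < ∑ a ∈ Ω (t + 1), w (t + 1) a := fun t ht =>
    Finset.sum_pos' (hwp t ht).1 ⟨lam (t + 1), hlam _ ht, (hwp t ht).2⟩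
  have hTrle : ∀ t < T, Tr (t + 1) (lam t) (lam (t + 1)) ≤ 1 := fun t ht => by
    rw [← hTr1 t ht (lam t) (hlam t ht.le)]
    exact Finset.single_le_sum (f := fun b => Tr (t + 1) (lam t) b)
      (fun b _ => hTr0 _ _ _) (hlam _ ht)
  have hηinv : ∀ t < T, 1 / η (t - 1) ≤ 1 / η t := fun t ht =>
    one_div_le_one_div_of_le (hηpos t ht.le) (hηanti t ht)
  have hN1 : (1 : ℝ) ≤ N := by
    have := hN 0 hT
    rw [hΩ0] at this
    exact_mod_cast this
  have upper : ∀ n ≤ T, 1 / η (n - 1) * Real.log (∑ a ∈ Ω n, z n a) ≤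
      Real.log N * (1 / η (n - 1) - 1 / η 0) +
        ∑ t ∈ Finset.Icc 1 n, 1 / η (t - 1) * Real.log (c t) := by
    intro n
    induction n with
    | zero =>
      intro _
      rw [Finset.sum_congr rfl hz0]
      simp [hΩ0]
    | succ n ih =>
      intro hn
      have hn' : n < T := hn
      have hS : ∑ a ∈ Ω (n + 1), w (n + 1) a = ∑ b ∈ Ω n, z n b ^ (η n / η (n - 1)) := by
        rw [Finset.sum_congr rfl (hw n hn'), Finset.sum_comm]
        refine Finset.sum_congr rfl fun b hb => ?_
        rw [← Finset.sum_mul, hTr1 n hn' b hb, one_mul]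
      have hηn := hηpos n hn'.le
      have hηn1 := hηpos (n - 1) (by omega)
      have hpm := log_sum_rpow_le (Ω n) (z n) (hzp n hn'.le).1 (hZpos n hn'.le)
        (div_pos hηn hηn1) ((div_le_one hηn1).mpr (hηanti n hn'))
      rw [Finset.sum_Icc_succ_top (by omega), Nat.add_sub_cancel, hc n hn',
        Real.log_mul (hSpos n hn').ne' (hcpos n hn').ne', hS]
      have hcard : Real.log (Ω n).card ≤ Real.log N :=
        Real.log_le_log (by exact_mod_cast Finset.card_pos.mpr ⟨_, hlam n hn'.le⟩)
          (by exact_mod_cast hN n hn')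
      have h1 := mul_le_mul_of_nonneg_left hpm (one_div_pos.mpr hηn).le
      have e1 : 1 / η n * ((1 - η n / η (n - 1)) * Real.log (Ω n).card +
          η n / η (n - 1) * Real.log (∑ a ∈ Ω n, z n a)) =
          (1 / η n - 1 / η (n - 1)) * Real.log (Ω n).card +
            1 / η (n - 1) * Real.log (∑ a ∈ Ω n, z n a) := by
        field_simp
      rw [e1] at h1
      have h2 := mul_le_mul_of_nonneg_left hcard (sub_nonneg.mpr (hηinv n hn'))
      linarith [ih hn'.le]
  have lower : ∀ n ≤ T, ∑ t ∈ Finset.Icc 1 n, (1 / η (n - 1) *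
      Real.log (Tr t (lam (t - 1)) (lam t)) - g t (lam t)) ≤
        1 / η (n - 1) * Real.log (z n (lam n)) := by
    intro n
    induction n with
    | zero =>
      intro h
      simp [hz0 _ (hlam 0 h)]
    | succ n ih =>
      intro hn
      have hn' : n < T := hn
      have hηn := hηpos n hn'.le
      have hηn1 := hηpos (n - 1) (by omega)
      have hzn := (hzp n hn'.le).2
      rw [Finset.sum_Icc_succ_top (by omega), Nat.add_sub_cancel, hz n hn' _ (hlam _ hn),
        Real.log_mul (hwp n hn').2.ne' (Real.exp_pos _).ne', Real.log_exp]
      have hwge : Tr (n + 1) (lam n) (lam (n + 1)) * z n (lam n) ^ (η n / η (n - 1)) ≤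
          w (n + 1) (lam (n + 1)) := by
        rw [hw n hn' _ (hlam _ hn)]
        exact Finset.single_le_sum
          (f := fun b => Tr (n + 1) b (lam (n + 1)) * z n b ^ (η n / η (n - 1)))
          (fun b hb => mul_nonneg (hTr0 _ _ _) (Real.rpow_nonneg ((hzp n hn'.le).1 b hb) _))
          (hlam n hn'.le)
      have hrp := Real.rpow_pos_of_pos hzn (η n / η (n - 1))
      have h1 := Real.log_le_log (mul_pos (hlamTr n hn') hrp) hwge
      rw [Real.log_mul (hlamTr n hn').ne' hrp.ne', Real.log_rpow hzn] at h1
      have h2 := mul_le_mul_of_nonneg_left h1 (one_div_pos.mpr hηn).le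
      have e1 : 1 / η n * (Real.log (Tr (n + 1) (lam n) (lam (n + 1))) +
          η n / η (n - 1) * Real.log (z n (lam n))) =
          1 / η n * Real.log (Tr (n + 1) (lam n) (lam (n + 1))) +
            1 / η (n - 1) * Real.log (z n (lam n)) := by
        field_simp
      have e2 : 1 / η n * (Real.log (w (n + 1) (lam (n + 1))) +
          -η n * g (n + 1) (lam (n + 1))) =
          1 / η n * Real.log (w (n + 1) (lam (n + 1))) - g (n + 1) (lam (n + 1)) := by
        field_simp
        ring
      rw [e1] at h2
      rw [e2]
      have h3 : ∑ t ∈ Finset.Icc 1 n, (1 / η n *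
          Real.log (Tr t (lam (t - 1)) (lam t)) - g t (lam t)) ≤
          ∑ t ∈ Finset.Icc 1 n, (1 / η (n - 1) *
            Real.log (Tr t (lam (t - 1)) (lam t)) - g t (lam t)) := by
        refine Finset.sum_le_sum fun t ht => ?_
        obtain ⟨ht1, htn⟩ := Finset.mem_Icc.mp ht
        obtain ⟨s, rfl⟩ := Nat.exists_eq_add_of_le' ht1
        have hlog : Real.log (Tr (s + 1) (lam s) (lam (s + 1))) ≤ 0 :=
          Real.log_nonpos (hTr0 _ _ _) (hTrle s (by omega))
        have := mul_le_mul_of_nonpos_right (hηinv n hn') hlog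
        simpa using this
      linarith [ih hn'.le]
  have hU := upper T le_rfl
  have hL := lower T le_rfl
  have hlogz : Real.log (z T (lam T)) ≤ Real.log (∑ a ∈ Ω T, z T a) :=
    Real.log_le_log (hzp T le_rfl).2
      (Finset.single_le_sum (f := z T) (hzp T le_rfl).1 (hlam T le_rfl))
  have hlogz' := mul_le_mul_of_nonneg_left hlogz
    (one_div_pos.mpr (hηpos (T - 1) (by omega))).le
  have hprod : Real.log (∏ t ∈ Finset.Icc 1 T, Tr t (lam (t - 1)) (lam t)) =
      ∑ t ∈ Finset.Icc 1 T, Real.log (Tr t (lam (t - 1)) (lam t)) := by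
    refine Real.log_prod fun t ht => ?_
    obtain ⟨ht1, htn⟩ := Finset.mem_Icc.mp ht
    obtain ⟨s, rfl⟩ := Nat.exists_eq_add_of_le' ht1
    exact (hlamTr s (by omega)).ne'
  rw [Finset.sum_sub_distrib, ← Finset.mul_sum, ← hprod] at hL
  have h0 : 0 ≤ Real.log N * (1 / η 0) :=
    mul_nonneg (Real.log_nonneg hN1) (one_div_pos.mpr (hηpos 0 (by omega))).le
  linarith

/-- Numerical trade-off between the three terms of the learning rate. -/
theorem rate_tradeoff_le {W V D F Δ Q η d : ℝ} (hW : 0 < W) (hV : 0 < V) (hD : 0 < D)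
    (hη : η = min (√W / √V) (min (W / D) (1 / F))) (hDΔ : D ≤ Δ) (hFΔ : F ≤ Δ)
    (hVQ : V ≤ Q / 4) (hd : d ≤ 1 / η) (hsmall : d ≤ 0 ∨ 2 / 3 ≤ W) :
    W * (1 / η) + d + 3 / 2 * (√W * √V) ≤ 2 * (1 + W) * Δ + 2 * √(W * Q) := by
  have hsW := Real.sqrt_pos.mpr hW
  have hsV := Real.sqrt_pos.mpr hV
  have hWW := Real.mul_self_sqrt hW.le
  have hB : 0 < √W * √V := mul_pos hsW hsV
  have hQ : 2 * (√W * √V) ≤ √(W * Q) := by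
    apply Real.le_sqrt_of_sq_le
    rw [mul_pow, mul_pow, Real.sq_sqrt hW.le, Real.sq_sqrt hV.le]
    nlinarith
  have hWΔ : 0 < W * Δ := mul_pos hW (hD.trans_le hDΔ)
  have key : W * (1 / η) ≤ √W * √V ∧ (2 / 3 ≤ W → 1 / η ≤ 3 / 2 * (√W * √V)) ∨
      W * (1 / η) ≤ D ∧ (2 / 3 ≤ W → 1 / η ≤ 3 / 2 * D) ∨
      W * (1 / η) ≤ W * F ∧ 1 / η ≤ F := by
    rcases min_choice (√W / √V) (min (W / D) (1 / F)) with h | h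
    · left
      rw [hη, h, one_div_div]
      have e : W * (√V / √W) = √W * √V := by
        rw [mul_div_assoc', div_eq_iff hsW.ne']
        nth_rewrite 1 [← hWW]
        ring
      refine ⟨e.le, fun hW' => ?_⟩
      rw [← e]
      have : 0 < √V / √W := div_pos hsV hsW
      nlinarith
    · rcases min_choice (W / D) (1 / F) with h' | h'
      · right; left
        rw [hη, h, h', one_div_div]
        have e : W * (D / W) = D := mul_div_cancel₀ D hW.ne'
        refine ⟨e.le, fun hW' => ?_⟩
        rw [div_le_iff₀ hW]
        nlinarith
      · right; right
        rw [hη, h, h', one_div_one_div]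
        exact ⟨le_rfl, le_rfl⟩
  rcases key with ⟨h1, h2⟩ | ⟨h1, h2⟩ | ⟨h1, h2⟩
  · rcases hsmall with h | h
    · linarith
    · linarith [h2 h]
  · rcases hsmall with h | h
    · linarith
    · linarith [h2 h, mul_le_mul_of_nonneg_right h (hD.le.trans hDΔ)]
  · linarith [mul_le_mul_of_nonneg_left hFΔ hW.le]

/-- The learning-rate statistics make the rates positive and nonincreasing. -/
theorem min_rate_antitone {W V V' D D' F F' : ℝ} (hW : 0 < W) (hV : 0 < V) (hD : 0 < D)
    (hF : 0 < F) (hVV : V ≤ V') (hDD : D ≤ D') (hFF : F ≤ F') :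
    min (√W / √V') (min (W / D') (1 / F')) ≤ min (√W / √V) (min (W / D) (1 / F)) := by
  refine min_le_min ?_ (min_le_min ?_ ?_)
  · exact div_le_div_of_nonneg_left (Real.sqrt_nonneg _) (Real.sqrt_pos.mpr hV)
      (Real.sqrt_le_sqrt hVV)
  · exact div_le_div_of_nonneg_left hW.le hD hDD
  · exact one_div_le_one_div_of_le hF hFF

/-- Telescoping over `Icc 1 n`. -/
theorem sum_Icc_one_sub_pred (x : ℕ → ℝ) (n : ℕ) :
    ∑ t ∈ Finset.Icc 1 n, (x t - x (t - 1)) = x n - x 0 := by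
  induction n with
  | zero => simp
  | succ n ih => rw [Finset.sum_Icc_succ_top (by omega), ih, Nat.add_sub_cancel]; ring

/-- Theorem (thm:11) of the paper: full-feedback data-dependent regret bound
with the parameter choice of Remark 2 (`φ_{t,m} = l_{t,m} − E_p[l_t]`,
`η_t = min(√W/√V_t, W/D_t, 1/|Φ_t|)`, `ε_t = 0`). -/
theorem stmt_11 (M T : ℕ) [NeZero M] (hM : 1 ≤ M) (hT : 1 ≤ T)
    (l : ℕ → Fin M → ℝ)
    (W : ℝ) (hW : 0 < W)
    {Λ : Type} (Ω : ℕ → Finset Λ)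
    (hΩne : ∀ t, t ≤ T → (Ω t).Nonempty)
    (hΩ0 : (Ω 0).card = 1)
    (lab : ℕ → Λ → Fin M)
    (Tr : ℕ → Λ → Λ → ℝ)
    (hTr0 : ∀ t a b, 0 ≤ Tr t a b)
    (hTr1 : ∀ t, 1 ≤ t → t ≤ T → ∀ a ∈ Ω (t - 1), ∑ b ∈ Ω t, Tr t a b = 1)
    (φ : ℕ → Fin M → ℝ) (η V D Φ : ℕ → ℝ)
    (w z : ℕ → Λ → ℝ) (p : ℕ → Fin M → ℝ)
    (hp : ∀ t, 1 ≤ t → t ≤ T → ∀ m,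
      p t m = (∑ a ∈ (Ω t).filter (fun a => lab t a = m), w t a) /
        ∑ m' : Fin M, ∑ a ∈ (Ω t).filter (fun a => lab t a = m'), w t a)
    (hφ : ∀ t, 1 ≤ t → t ≤ T → ∀ m,
      φ t m = l t m - ∑ m', p t m' * l t m')
    (hV : ∀ t, 1 ≤ t → t ≤ T →
      V t = ∑ t' ∈ Finset.Icc 1 t, ∑ m, p t' m * (φ t' m) ^ 2)
    (hD : ∀ t, ∀ ht1 : 1 ≤ t, t ≤ T →
      D t = (Finset.Icc 1 t).sup' (Finset.nonempty_Icc.mpr ht1)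
        (fun t' => Finset.univ.sup' Finset.univ_nonempty (φ t') -
          Finset.univ.inf' Finset.univ_nonempty (φ t')))
    (hΦ : ∀ t, ∀ ht1 : 1 ≤ t, t ≤ T →
      Φ t = (Finset.Icc 1 t).inf' (Finset.nonempty_Icc.mpr ht1)
        (fun t' => Finset.univ.inf' Finset.univ_nonempty (φ t')))
    (hη : ∀ t, 1 ≤ t → t ≤ T →
      η t = min (Real.sqrt W / Real.sqrt (V t)) (min (W / D t) (1 / |Φ t|)))
    (hη0 : η 0 = η 1)
    (hV1 : 0 < V 1) (hD1 : 0 < D 1) (hΦ1 : 0 < |Φ 1|)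
    (hw0 : ∀ a ∈ Ω 0, w 0 a = 1)
    (hz0 : ∀ a ∈ Ω 0, z 0 a = 1)
    (hw : ∀ t, 1 ≤ t → t ≤ T → ∀ a ∈ Ω t,
      w t a = ∑ b ∈ Ω (t - 1), Tr t b a * z (t - 1) b ^ (η (t - 1) / η (t - 2)))
    (hz : ∀ t, 1 ≤ t → t ≤ T → ∀ a ∈ Ω t,
      z t a = w t a * Real.exp (-η (t - 1) * φ t (lab t a)))
    (lam : ℕ → Λ)
    (hlam : ∀ t, t ≤ T → lam t ∈ Ω t)
    (hlamTr : ∀ t, 1 ≤ t → t ≤ T → 0 < Tr t (lam (t - 1)) (lam t))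
    (hcomp : Real.log (((Finset.Icc 1 T).sup fun t => (Ω (t - 1)).card : ℕ) : ℝ)
      - Real.log (∏ t ∈ Finset.Icc 1 T, Tr t (lam (t - 1)) (lam t)) ≤ W) :
    ∑ t ∈ Finset.Icc 1 T, ((∑ m, p t m * l t m) - l t (lab t (lam t))) ≤
      2 * (1 + W) *
        ((Finset.Icc 1 T).sup' (Finset.nonempty_Icc.mpr hT)
          (fun t => Finset.univ.sup' Finset.univ_nonempty (l t) -
            Finset.univ.inf' Finset.univ_nonempty (l t)))
      + 2 * Real.sqrt (W * ∑ t ∈ Finset.Icc 1 T,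
          (Finset.univ.sup' Finset.univ_nonempty (l t) -
            Finset.univ.inf' Finset.univ_nonempty (l t)) ^ 2) := by
  have hw' : ∀ t < T, ∀ a ∈ Ω (t + 1),
      w (t + 1) a = ∑ b ∈ Ω t, Tr (t + 1) b a * z t b ^ (η t / η (t - 1)) :=
    fun t ht a ha => by simpa using hw (t + 1) (by omega) ht a ha
  have hz' : ∀ t < T, ∀ a ∈ Ω (t + 1),
      z (t + 1) a = w (t + 1) a * Real.exp (-η t * φ (t + 1) (lab (t + 1) a)) :=
    fun t ht a ha => by simpa using hz (t + 1) (by omega) ht a ha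
  have hTr1' : ∀ t < T, ∀ a ∈ Ω t, ∑ b ∈ Ω (t + 1), Tr (t + 1) a b = 1 :=
    fun t ht a ha => hTr1 (t + 1) (by omega) ht a (by simpa using ha)
  have hlamTr' : ∀ t < T, 0 < Tr (t + 1) (lam t) (lam (t + 1)) :=
    fun t ht => by simpa using hlamTr (t + 1) (by omega) ht
  obtain ⟨-, hwp'⟩ := weights_nonneg_and_pos T Ω Tr hTr0 (fun t => η t / η (t - 1)) w z
    (fun t a => Real.exp (-η (t - 1) * φ t (lab t a))) (fun _ _ => Real.exp_pos _) hz0 hw' hz'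
    lam hlam hlamTr'
  have hwp : ∀ t, 1 ≤ t → t ≤ T → (∀ a ∈ Ω t, 0 ≤ w t a) ∧ 0 < w t (lam t) := by
    intro t h1 ht
    obtain ⟨s, rfl⟩ := Nat.exists_eq_add_of_le' h1
    exact hwp' s ht
  have hfib : ∀ t, ∑ m' : Fin M, ∑ a ∈ (Ω t).filter (fun a => lab t a = m'), w t a =
      ∑ a ∈ Ω t, w t a := fun t => Finset.sum_fiberwise _ _ _
  have hSpos : ∀ t, 1 ≤ t → t ≤ T → 0 < ∑ a ∈ Ω t, w t a := fun t h1 ht =>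
    Finset.sum_pos' (hwp t h1 ht).1 ⟨lam t, hlam t ht, (hwp t h1 ht).2⟩
  have hp0 : ∀ t, 1 ≤ t → t ≤ T → ∀ m, 0 ≤ p t m := fun t h1 ht m => by
    rw [hp t h1 ht, hfib]
    exact div_nonneg (Finset.sum_nonneg fun a ha =>
      (hwp t h1 ht).1 a (Finset.mem_filter.mp ha).1) (hSpos t h1 ht).le
  have hp1 : ∀ t, 1 ≤ t → t ≤ T → ∑ m, p t m = 1 := fun t h1 ht => by
    rw [Finset.sum_congr rfl fun m _ => hp t h1 ht m, ← Finset.sum_div, hfib]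
    exact div_self (hSpos t h1 ht).ne'
  have hcen : ∀ t, 1 ≤ t → t ≤ T → ∑ m, p t m * φ t m = 0 := fun t h1 ht => by
    have : ∀ m, p t m * φ t m = p t m * l t m - p t m * ∑ m', p t m' * l t m' := fun m => by
      rw [hφ t h1 ht]; ring
    rw [Finset.sum_congr rfl fun m _ => this m, Finset.sum_sub_distrib, ← Finset.sum_mul,
      hp1 t h1 ht, one_mul, sub_self]
  set lo : ℕ → ℝ := fun t => Finset.univ.inf' Finset.univ_nonempty (l t) with hlo
  set hi : ℕ → ℝ := fun t => Finset.univ.sup' Finset.univ_nonempty (l t) with hhi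
  have hlo_le : ∀ t m, lo t ≤ l t m := fun t m => Finset.inf'_le _ (Finset.mem_univ m)
  have hle_hi : ∀ t m, l t m ≤ hi t := fun t m => Finset.le_sup' _ (Finset.mem_univ m)
  have hmean_lo : ∀ t, 1 ≤ t → t ≤ T → lo t ≤ ∑ m, p t m * l t m := fun t h1 ht => by
    calc lo t = ∑ m, p t m * lo t := by rw [← Finset.sum_mul, hp1 t h1 ht, one_mul]
      _ ≤ _ := Finset.sum_le_sum fun m _ => mul_le_mul_of_nonneg_left (hlo_le t m) (hp0 t h1 ht m)
  have hmean_hi : ∀ t, 1 ≤ t → t ≤ T → ∑ m, p t m * l t m ≤ hi t := fun t h1 ht => by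
    calc _ ≤ ∑ m, p t m * hi t :=
          Finset.sum_le_sum fun m _ => mul_le_mul_of_nonneg_left (hle_hi t m) (hp0 t h1 ht m)
      _ = hi t := by rw [← Finset.sum_mul, hp1 t h1 ht, one_mul]
  have hinf : ∀ t, 1 ≤ t → t ≤ T → Finset.univ.inf' Finset.univ_nonempty (φ t) =
      lo t - ∑ m, p t m * l t m := fun t h1 ht => by
    obtain ⟨m, -, hm⟩ := Finset.exists_mem_eq_inf' (Finset.univ_nonempty (α := Fin M)) (l t)
    apply le_antisymm
    · calc _ ≤ φ t m := Finset.inf'_le _ (Finset.mem_univ m)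
        _ = _ := by rw [hφ t h1 ht, ← hm]
    · refine Finset.le_inf' _ _ fun m _ => ?_
      rw [hφ t h1 ht]
      linarith [hlo_le t m]
  have hsup : ∀ t, 1 ≤ t → t ≤ T → Finset.univ.sup' Finset.univ_nonempty (φ t) =
      hi t - ∑ m, p t m * l t m := fun t h1 ht => by
    obtain ⟨m, -, hm⟩ := Finset.exists_mem_eq_sup' (Finset.univ_nonempty (α := Fin M)) (l t)
    apply le_antisymm
    · refine Finset.sup'_le _ _ fun m _ => ?_
      rw [hφ t h1 ht]
      linarith [hle_hi t m]
    · calc _ = φ t m := by rw [hφ t h1 ht, ← hm]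
        _ ≤ _ := Finset.le_sup' _ (Finset.mem_univ m)
  set Δ := (Finset.Icc 1 T).sup' (Finset.nonempty_Icc.mpr hT) (fun t => hi t - lo t) with hΔ
  have hleΔ : ∀ t, 1 ≤ t → t ≤ T → hi t - lo t ≤ Δ := fun t h1 ht =>
    Finset.le_sup' (fun t => hi t - lo t) (Finset.mem_Icc.mpr ⟨h1, ht⟩)
  have hv0 : ∀ t, 1 ≤ t → t ≤ T → 0 ≤ ∑ m, p t m * φ t m ^ 2 := fun t h1 ht =>
    Finset.sum_nonneg fun m _ => mul_nonneg (hp0 t h1 ht m) (sq_nonneg _)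
  have hVmono : ∀ s t, 1 ≤ s → s ≤ t → t ≤ T → V s ≤ V t := fun s t h1 hst ht => by
    rw [hV s h1 (hst.trans ht), hV t (h1.trans hst) ht]
    refine Finset.sum_le_sum_of_subset_of_nonneg (Finset.Icc_subset_Icc_right hst)
      fun i hi _ => ?_
    obtain ⟨hi1, hi2⟩ := Finset.mem_Icc.mp hi
    exact hv0 i hi1 (hi2.trans ht)
  have hDmono : ∀ s t, 1 ≤ s → s ≤ t → t ≤ T → D s ≤ D t := fun s t h1 hst ht => by
    rw [hD s h1 (hst.trans ht), hD t (h1.trans hst) ht]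
    exact Finset.sup'_mono _ (Finset.Icc_subset_Icc_right hst) _
  have hΦmono : ∀ s t, 1 ≤ s → s ≤ t → t ≤ T → Φ t ≤ Φ s := fun s t h1 hst ht => by
    rw [hΦ s h1 (hst.trans ht), hΦ t (h1.trans hst) ht]
    exact Finset.inf'_mono _ (Finset.Icc_subset_Icc_right hst) _
  have hΦle : ∀ t, 1 ≤ t → t ≤ T → Φ t ≤ lo t - ∑ m, p t m * l t m := fun t h1 ht => by
    rw [← hinf t h1 ht, hΦ t h1 ht]
    exact Finset.inf'_le (fun t' => Finset.univ.inf' Finset.univ_nonempty (φ t'))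
      (Finset.mem_Icc.mpr ⟨h1, le_rfl⟩)
  have hΦabs : ∀ t, 1 ≤ t → t ≤ T → |Φ t| = -Φ t := fun t h1 ht =>
    abs_of_nonpos (by linarith [hΦle t h1 ht, hmean_lo t h1 ht])
  have hFmono : ∀ s t, 1 ≤ s → s ≤ t → t ≤ T → |Φ s| ≤ |Φ t| := fun s t h1 hst ht => by
    rw [hΦabs s h1 (hst.trans ht), hΦabs t (h1.trans hst) ht]
    linarith [hΦmono s t h1 hst ht]
  have hVpos : ∀ t, 1 ≤ t → t ≤ T → 0 < V t := fun t h1 ht =>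
    hV1.trans_le (hVmono 1 t le_rfl h1 ht)
  have hDpos : ∀ t, 1 ≤ t → t ≤ T → 0 < D t := fun t h1 ht =>
    hD1.trans_le (hDmono 1 t le_rfl h1 ht)
  have hFpos : ∀ t, 1 ≤ t → t ≤ T → 0 < |Φ t| := fun t h1 ht =>
    hΦ1.trans_le (hFmono 1 t le_rfl h1 ht)
  have hηpos1 : ∀ t, 1 ≤ t → t ≤ T → 0 < η t := fun t h1 ht => by
    rw [hη t h1 ht]
    exact lt_min (div_pos (Real.sqrt_pos.mpr hW) (Real.sqrt_pos.mpr (hVpos t h1 ht)))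
      (lt_min (div_pos hW (hDpos t h1 ht)) (one_div_pos.mpr (hFpos t h1 ht)))
  have hηpos : ∀ t ≤ T, 0 < η t := fun t ht => by
    rcases Nat.eq_zero_or_pos t with rfl | h1
    · rw [hη0]
      exact hηpos1 1 le_rfl hT
    · exact hηpos1 t h1 ht
  have hηanti : ∀ t ≤ T, η t ≤ η (t - 1) := fun t ht => by
    rcases t with _ | _ | t
    · exact le_rfl
    · simp [hη0]
    · rw [Nat.add_sub_cancel, hη (t + 1) (by omega) (by omega), hη (t + 1 + 1) (by omega) ht]
      exact min_rate_antitone hW (hVpos _ (by omega) (by omega)) (hDpos _ (by omega) (by omega))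
        (hFpos _ (by omega) (by omega)) (hVmono _ _ (by omega) (by omega) ht)
        (hDmono _ _ (by omega) (by omega) ht) (hFmono _ _ (by omega) (by omega) ht)
  set N := (Finset.Icc 1 T).sup fun t => (Ω (t - 1)).card with hNdef
  have hN : ∀ t < T, (Ω t).card ≤ N := fun t ht =>
    Finset.le_sup (f := fun t => (Ω (t - 1)).card) (Finset.mem_Icc.mpr ⟨by omega, ht⟩ :
      t + 1 ∈ Finset.Icc 1 T)
  have hmix : ∀ t < T, ∑ a ∈ Ω (t + 1), z (t + 1) a = (∑ a ∈ Ω (t + 1), w (t + 1) a) *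
      ∑ m, p (t + 1) m * Real.exp (-η (t + 1 - 1) * φ (t + 1) m) := fun t ht => by
    rw [Finset.mul_sum, Nat.add_sub_cancel, ← Finset.sum_fiberwise (Ω (t + 1)) (lab (t + 1))]
    refine Finset.sum_congr rfl fun m _ => ?_
    rw [hp (t + 1) (by omega) ht, hfib, ← mul_assoc,
      mul_div_cancel₀ _ (hSpos (t + 1) (by omega) ht).ne', Finset.sum_mul]
    refine Finset.sum_congr rfl fun a ha => ?_
    obtain ⟨haΩ, rfl⟩ := Finset.mem_filter.mp ha
    exact hz' t ht a haΩ
  have hmixpos : ∀ t < T, 0 < ∑ m, p (t + 1) m * Real.exp (-η (t + 1 - 1) * φ (t + 1) m) :=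
    fun t ht => by
    obtain ⟨m, -, hm⟩ : ∃ m ∈ Finset.univ, p (t + 1) m ≠ 0 :=
      Finset.exists_ne_zero_of_sum_ne_zero
        (by rw [hp1 (t + 1) (by omega) ht]; exact one_ne_zero)
    exact Finset.sum_pos' (fun i _ => mul_nonneg (hp0 _ (by omega) ht i) (Real.exp_pos _).le)
      ⟨m, Finset.mem_univ m,
        mul_pos (lt_of_le_of_ne (hp0 _ (by omega) ht m) (Ne.symm hm)) (Real.exp_pos _)⟩
  have hreg := neg_sum_le_of_weights T Ω Tr hTr0 hTr1' hΩ0 N hN η hηpos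
    (fun t ht => hηanti t ht.le) w z (fun t a => φ t (lab t a)) hz0 hw' hz' lam hlam hlamTr'
    (fun t => ∑ m, p t m * Real.exp (-η (t - 1) * φ t m)) hmix hmixpos hT
  have hloss : ∑ t ∈ Finset.Icc 1 T, 1 / η (t - 1) *
      Real.log (∑ m, p t m * Real.exp (-η (t - 1) * φ t m)) ≤
      ∑ t ∈ Finset.Icc 1 T, (3 / 4 * (√W *
        ((∑ m, p t m * φ t m ^ 2) / √(V t))) + (1 / η t - 1 / η (t - 1))) := by
    refine Finset.sum_le_sum fun t ht => ?_
    obtain ⟨h1, ht⟩ := Finset.mem_Icc.mp ht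
    have hstep := log_sum_exp_div_le (p t) (φ t) (η (t - 1)) (η t) (hp0 t h1 ht) (hp1 t h1 ht)
      (hcen t h1 ht) (hηpos t ht) (hηanti t ht) fun m => by
        have hηF : η t ≤ 1 / |Φ t| := by
          rw [hη t h1 ht]
          exact (min_le_right _ _).trans (min_le_right _ _)
        have := one_div_le_one_div_of_le (hηpos t ht) hηF
        rw [one_div_one_div, hΦabs t h1 ht] at this
        have h2 := hΦle t h1 ht
        rw [hφ t h1 ht]
        linarith [hlo_le t m]
    have hηV : η t ≤ √W / √(V t) := by
      rw [hη t h1 ht]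
      exact min_le_left _ _
    have := mul_le_mul_of_nonneg_right hηV (hv0 t h1 ht)
    have e : √W / √(V t) * ∑ m, p t m * φ t m ^ 2 =
      √W * ((∑ m, p t m * φ t m ^ 2) / √(V t)) := by ring
    linarith
  have hquad : ∑ t ∈ Finset.Icc 1 T, (∑ m, p t m * φ t m ^ 2) / √(V t) ≤ 2 * √(V T) := by
    have hs := sum_div_sqrt_partial_sum_le
      (fun t => if t ≤ T then ∑ m, p t m * φ t m ^ 2 else 0)
      (fun t h1 => by
        split_ifs with h
        exacts [hv0 t h1 h, le_rfl]) T
    have hpart : ∀ t, 1 ≤ t → t ≤ T → ∑ s ∈ Finset.Icc 1 t,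
        (if s ≤ T then ∑ m, p s m * φ s m ^ 2 else 0) = V t := fun t h1 ht => by
      rw [hV t h1 ht]
      exact Finset.sum_congr rfl fun s hs =>
        if_pos ((Finset.mem_Icc.mp hs).2.trans ht)
    rw [hpart T hT le_rfl] at hs
    refine le_trans (le_of_eq (Finset.sum_congr rfl fun t ht => ?_)) hs
    obtain ⟨h1, ht⟩ := Finset.mem_Icc.mp ht
    rw [hpart t h1 ht]
    simp only [if_pos ht]
  have htele := sum_Icc_one_sub_pred (fun t => 1 / η t) T
  rw [Finset.sum_add_distrib, ← Finset.mul_sum, ← Finset.mul_sum, htele] at hloss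
  have hquadW := mul_le_mul_of_nonneg_left hquad (Real.sqrt_nonneg W)
  have hDΔ : D T ≤ Δ := by
    rw [hD T hT le_rfl]
    refine Finset.sup'_le _ _ fun t ht => ?_
    obtain ⟨h1, ht⟩ := Finset.mem_Icc.mp ht
    rw [hsup t h1 ht, hinf t h1 ht]
    linarith [hleΔ t h1 ht]
  have hFΔ : |Φ T| ≤ Δ := by
    rw [hΦabs T hT le_rfl, neg_le, hΦ T hT le_rfl]
    refine Finset.le_inf' _ _ fun t ht => ?_
    obtain ⟨h1, ht⟩ := Finset.mem_Icc.mp ht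
    rw [hinf t h1 ht]
    linarith [hleΔ t h1 ht, hmean_hi t h1 ht]
  have hVQ : V T ≤ (∑ t ∈ Finset.Icc 1 T, (hi t - lo t) ^ 2) / 4 := by
    rw [hV T hT le_rfl, Finset.sum_div]
    refine Finset.sum_le_sum fun t ht => ?_
    obtain ⟨h1, ht⟩ := Finset.mem_Icc.mp ht
    have := sum_mul_sq_le_of_centred (p t) (φ t) (lo t - ∑ m, p t m * l t m)
      (hi t - ∑ m, p t m * l t m) (hp0 t h1 ht) (hp1 t h1 ht) (hcen t h1 ht)
      (fun m => by rw [hφ t h1 ht]; linarith [hlo_le t m])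
      (fun m => by rw [hφ t h1 ht]; linarith [hle_hi t m])
    rwa [sub_sub_sub_cancel_right] at this
  have hsmall : 1 / η T - 1 / η 0 ≤ 0 ∨ 2 / 3 ≤ W := by
    rcases hT.eq_or_lt with rfl | hT2
    · left
      rw [hη0, sub_self]
    · right
      have hcard : 2 ≤ (Ω 1).card := by
        by_contra hlt
        have hone : ∀ a ∈ Ω 1, a = lam 1 := fun a ha =>
          Finset.card_le_one.mp (by omega) a ha _ (hlam 1 hT)
        have hpz : ∀ m, m ≠ lab 1 (lam 1) → p 1 m = 0 := fun m hm => by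
          rw [hp 1 le_rfl hT, Finset.sum_eq_zero, zero_div]
          intro a ha
          obtain ⟨ha, hla⟩ := Finset.mem_filter.mp ha
          rw [hone a ha] at hla
          exact absurd hla.symm hm
        have hc1 := hcen 1 le_rfl hT
        rw [Finset.sum_eq_single (lab 1 (lam 1)) (fun m _ hm => by rw [hpz m hm, zero_mul])
          (fun h => absurd (Finset.mem_univ _) h)] at hc1
        rw [hV 1 le_rfl hT, Finset.Icc_self, Finset.sum_singleton,
          Finset.sum_eq_single (lab 1 (lam 1)) (fun m _ hm => by rw [hpz m hm, zero_mul])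
          (fun h => absurd (Finset.mem_univ _) h), sq, ← mul_assoc, hc1, zero_mul] at hV1
        exact lt_irrefl _ hV1
      have hlogN : Real.log 2 ≤ Real.log N :=
        Real.log_le_log two_pos (by exact_mod_cast hcard.trans (hN 1 hT2))
      have hprod0 : 0 ≤ ∏ t ∈ Finset.Icc 1 T, Tr t (lam (t - 1)) (lam t) :=
        Finset.prod_nonneg fun t _ => hTr0 _ _ _
      have hprod1 : ∏ t ∈ Finset.Icc 1 T, Tr t (lam (t - 1)) (lam t) ≤ 1 := by
        refine Finset.prod_le_one (fun t _ => hTr0 _ _ _) fun t ht => ?_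
        obtain ⟨h1, ht⟩ := Finset.mem_Icc.mp ht
        rw [← hTr1 t h1 ht (lam (t - 1)) (hlam _ (by omega))]
        exact Finset.single_le_sum (f := fun b => Tr t (lam (t - 1)) b)
          (fun b _ => hTr0 _ _ _) (hlam t ht)
      linarith [Real.log_nonpos hprod0 hprod1, Real.log_two_gt_d9]
  have hfinal := rate_tradeoff_le hW (hVpos T hT le_rfl) (hDpos T hT le_rfl)
    (hη T hT le_rfl) hDΔ hFΔ hVQ
    (by linarith [one_div_pos.mpr (hηpos 0 (by omega))] :
      1 / η T - 1 / η 0 ≤ 1 / η T) hsmall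
  have hcompη : 1 / η (T - 1) *
      (Real.log N - Real.log (∏ t ∈ Finset.Icc 1 T, Tr t (lam (t - 1)) (lam t))) ≤
      W * (1 / η T) := by
    rw [mul_comm W]
    exact (mul_le_mul_of_nonneg_left hcomp (one_div_pos.mpr (hηpos _ (by omega))).le).trans
      (mul_le_mul_of_nonneg_right
        (one_div_le_one_div_of_le (hηpos T le_rfl) (hηanti T le_rfl)) hW.le)
  have hlhs : ∑ t ∈ Finset.Icc 1 T, ((∑ m, p t m * l t m) - l t (lab t (lam t))) =
      -∑ t ∈ Finset.Icc 1 T, φ t (lab t (lam t)) := by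
    rw [← Finset.sum_neg_distrib]
    refine Finset.sum_congr rfl fun t ht => ?_
    obtain ⟨h1, ht⟩ := Finset.mem_Icc.mp ht
    rw [hφ t h1 ht, neg_sub]
  rw [hlhs]
  linarith
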